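/- Let H = Σ_{i=1}^n h_i·σ_i act on (ℂ²)^{⊗n}, where h_i·σ_i denotes the operator h_{i,1}X + h_{i,2}Y + h_{i,3}Z acting on the i-th tensor factor (and identity elsewhere), with h_i ∈ ℝ³. Then E_gs(H) = −Σ_i ‖h_i‖₂, E_STAB(H) = −Σ_i max{|h_{i,x}|, |h_{i,y}|, |h_{i,z}|}, and hence the stabilizer gap is additive: δ_STAB(H) = Σ_{i=1}^n (‖h_i‖₂ − max{|h_{i,x}|, |h_{i,y}|, |h_{i,z}|}). -/

import Mathlib

open Matrix BigOperators

noncomputable section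

/-- Operators on the `n`-qubit Hilbert space `(ℂ²)^{⊗n}`. -/
abbrev QOp (n : ℕ) := Matrix (Fin n → Fin 2) (Fin n → Fin 2) ℂ

/-- Vectors in the `n`-qubit Hilbert space. -/
abbrev QVec (n : ℕ) := (Fin n → Fin 2) → ℂ

/-- The Pauli X matrix. -/
def PX : Matrix (Fin 2) (Fin 2) ℂ := !![0, 1; 1, 0]
/-- The Pauli Y matrix. -/
def PY : Matrix (Fin 2) (Fin 2) ℂ := !![0, -Complex.I; Complex.I, 0]
/-- The Pauli Z matrix. -/
def PZ : Matrix (Fin 2) (Fin 2) ℂ := !![1, 0; 0, -1]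

/-- Tensor product of single-qubit operators, one per site. -/
def tens {n : ℕ} (P : Fin n → Matrix (Fin 2) (Fin 2) ℂ) : QOp n :=
  Matrix.of fun v w => ∏ i, P i (v i) (w i)

/-- An element of the `n`-qubit Pauli group: a phase `±1, ±i` times a tensor
product of `I, X, Y, Z`. -/
def IsPauli {n : ℕ} (A : QOp n) : Prop :=
  ∃ c : ℂ, (c = 1 ∨ c = -1 ∨ c = Complex.I ∨ c = -Complex.I) ∧
    ∃ P : Fin n → Matrix (Fin 2) (Fin 2) ℂ,
      (∀ i, P i = 1 ∨ P i = PX ∨ P i = PY ∨ P i = PZ) ∧ A = c • tens P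

/-- A stabilizer group: an abelian subgroup of the `n`-qubit Pauli group not
containing `-I` (presented as a set of matrices closed under multiplication). -/
structure IsStabGroup {n : ℕ} (S : Set (QOp n)) : Prop where
  pauli : ∀ A ∈ S, IsPauli A
  one_mem : (1 : QOp n) ∈ S
  mul_mem : ∀ A ∈ S, ∀ B ∈ S, A * B ∈ S
  comm : ∀ A ∈ S, ∀ B ∈ S, A * B = B * A
  neg_one_not_mem : -(1 : QOp n) ∉ S

/-- A maximal (rank-`n`) stabilizer group has `2^n` elements. -/
def IsMaxStabGroup {n : ℕ} (S : Set (QOp n)) : Prop :=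
  IsStabGroup S ∧ Nat.card S = 2 ^ n

/-- A pure stabilizer state: a unit vector fixed by every element of some
maximal stabilizer group. -/
def IsPureStab {n : ℕ} (ψ : QVec n) : Prop :=
  star ψ ⬝ᵥ ψ = 1 ∧
    ∃ S : Set (QOp n), IsMaxStabGroup S ∧ ∀ A ∈ S, A.mulVec ψ = ψ

/-- The projector `|ψ⟩⟨ψ|`. -/
def proj {n : ℕ} (ψ : QVec n) : QOp n := Matrix.vecMulVec ψ (star ψ)

/-- The stabilizer polytope `STAB_n`: the convex hull of the projectors onto
pure stabilizer states. -/
def StabPolytope (n : ℕ) : Set (QOp n) :=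
  convexHull ℝ {M : QOp n | ∃ ψ : QVec n, IsPureStab ψ ∧ M = proj ψ}

/-- The stabilizer ground-state energy `E_STAB(H) = min_{ρ ∈ STAB_n} tr(Hρ)`. -/
def stabEnergy {n : ℕ} (H : QOp n) : ℝ :=
  sInf ((fun ρ => ((H * ρ).trace).re) '' StabPolytope n)

/-- The minimal eigenvalue `E_gs(H)` of a matrix. -/
def minEig {m : Type} [Fintype m] [DecidableEq m] (H : Matrix m m ℂ) : ℝ :=
  sInf {E : ℝ | ∃ ψ : m → ℂ, ψ ≠ 0 ∧ H.mulVec ψ = (E : ℂ) • ψ}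

/-- The stabilizer gap `δ_STAB(H) = E_STAB(H) − E_gs(H)`. -/
def stabGap {n : ℕ} (H : QOp n) : ℝ := stabEnergy H - minEig H

/-- The single-site operator `A` acting on qubit `i` (identity elsewhere). -/
def siteOp {n : ℕ} (i : Fin n) (A : Matrix (Fin 2) (Fin 2) ℂ) : QOp n :=
  tens (fun j => if j = i then A else 1)

/-- `r·σ` as a single-qubit matrix. -/
def dotSigma (r : Fin 3 → ℝ) : Matrix (Fin 2) (Fin 2) ℂ :=
  (r 0 : ℂ) • PX + (r 1 : ℂ) • PY + (r 2 : ℂ) • PZ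

/-! ### Single-qubit Pauli matrices -/

/-- The three Pauli matrices, indexed by the axes. -/
def pauli : Fin 3 → Matrix (Fin 2) (Fin 2) ℂ := ![PX, PY, PZ]

lemma dotSigma_eq_sum (r : Fin 3 → ℝ) : dotSigma r = ∑ k, (r k : ℂ) • pauli k := by
  simp [dotSigma, pauli, Fin.sum_univ_three]

lemma pauli_mul_self (k : Fin 3) : pauli k * pauli k = 1 := by
  fin_cases k <;> ext i j <;> fin_cases i <;> fin_cases j <;> simp [pauli, PX, PY, PZ]

lemma pauli_anticomm {k l : Fin 3} (hkl : k ≠ l) : pauli k * pauli l = -(pauli l * pauli k) := by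
  fin_cases k <;> fin_cases l <;> first | exact absurd rfl hkl | skip
  all_goals ext i j; fin_cases i <;> fin_cases j <;> simp [pauli, PX, PY, PZ]

lemma conjTranspose_pauli (k : Fin 3) : (pauli k)ᴴ = pauli k := by
  fin_cases k <;> ext i j <;> fin_cases i <;> fin_cases j <;> simp [pauli, PX, PY, PZ]

lemma trace_pauli (k : Fin 3) : (pauli k).trace = 0 := by
  fin_cases k <;> simp [pauli, PX, PY, PZ, Matrix.trace_fin_two]

lemma eq_one_or_eq_pauli_iff {M : Matrix (Fin 2) (Fin 2) ℂ} :
    (M = 1 ∨ M = PX ∨ M = PY ∨ M = PZ) ↔ (M = 1 ∨ ∃ k, M = pauli k) := by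
  simp [Fin.exists_fin_succ, pauli]

lemma conjTranspose_dotSigma (r : Fin 3 → ℝ) : (dotSigma r)ᴴ = dotSigma r := by
  simp [dotSigma_eq_sum, Matrix.conjTranspose_sum, Matrix.conjTranspose_smul, conjTranspose_pauli]

lemma trace_dotSigma (r : Fin 3 → ℝ) : (dotSigma r).trace = 0 := by
  simp [dotSigma_eq_sum, Matrix.trace_sum, trace_pauli]

lemma dotSigma_mul_self (r : Fin 3 → ℝ) :
    dotSigma r * dotSigma r = ((Real.sqrt (∑ k, r k ^ 2) : ℂ) ^ 2) • 1 := by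
  have hs : (Real.sqrt (∑ k, r k ^ 2) : ℂ) ^ 2 = ∑ k, (r k : ℂ) ^ 2 := by
    rw [← Complex.ofReal_pow, Real.sq_sqrt (by positivity)]
    push_cast
    rfl
  rw [hs]
  ext i j
  fin_cases i <;> fin_cases j <;>
    simp [dotSigma, PX, PY, PZ, Matrix.mul_apply, Fin.sum_univ_three] <;> ring_nf <;>
    simp only [Complex.I_sq] <;> ring

/-! ### Tensor products of operators and vectors -/

section Tensor

variable {n : ℕ}

lemma tens_mul (P Q : Fin n → Matrix (Fin 2) (Fin 2) ℂ) :
    tens P * tens Q = tens fun i => P i * Q i := by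
  ext v w
  simp only [tens, Matrix.mul_apply, Matrix.of_apply, ← Finset.prod_mul_distrib]
  rw [Finset.prod_univ_sum, Fintype.piFinset_univ]

lemma tens_smul (c : Fin n → ℂ) (P : Fin n → Matrix (Fin 2) (Fin 2) ℂ) :
    (tens fun i => c i • P i) = (∏ i, c i) • tens P := by
  ext v w
  simp [tens, Finset.prod_mul_distrib]

lemma tens_one : (tens fun _ : Fin n => (1 : Matrix (Fin 2) (Fin 2) ℂ)) = 1 := by
  ext v w
  simp only [tens, Matrix.of_apply, Matrix.one_apply, Finset.prod_ite_zero, funext_iff]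
  simp

lemma conjTranspose_tens (P : Fin n → Matrix (Fin 2) (Fin 2) ℂ) :
    (tens P)ᴴ = tens fun i => (P i)ᴴ := by
  ext v w
  simp [tens, Matrix.conjTranspose_apply]

lemma trace_tens (P : Fin n → Matrix (Fin 2) (Fin 2) ℂ) :
    (tens P).trace = ∏ i, (P i).trace := by
  simp only [tens, Matrix.trace, Matrix.diag_apply, Matrix.of_apply]
  rw [Finset.prod_univ_sum, Fintype.piFinset_univ]

/-- Tensor product of single-qubit vectors, one per site. -/
def tensVec (φ : Fin n → Fin 2 → ℂ) : QVec n := fun v => ∏ i, φ i (v i)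

lemma tens_mulVec_tensVec (P : Fin n → Matrix (Fin 2) (Fin 2) ℂ) (φ : Fin n → Fin 2 → ℂ) :
    tens P *ᵥ tensVec φ = tensVec fun i => P i *ᵥ φ i := by
  ext v
  simp only [tens, tensVec, Matrix.mulVec, dotProduct, Matrix.of_apply, ← Finset.prod_mul_distrib]
  rw [Finset.prod_univ_sum, Fintype.piFinset_univ]

lemma tensVec_smul (c : Fin n → ℂ) (φ : Fin n → Fin 2 → ℂ) :
    (tensVec fun i => c i • φ i) = (∏ i, c i) • tensVec φ := by
  ext v
  simp [tensVec, Finset.prod_mul_distrib]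

lemma star_tensVec_dotProduct (φ : Fin n → Fin 2 → ℂ) :
    star (tensVec φ) ⬝ᵥ tensVec φ = ∏ i, star (φ i) ⬝ᵥ φ i := by
  simp only [tensVec, dotProduct, Pi.star_apply, star_prod, ← Finset.prod_mul_distrib]
  rw [Finset.prod_univ_sum, Fintype.piFinset_univ]

lemma siteOp_mul (i : Fin n) (A B : Matrix (Fin 2) (Fin 2) ℂ) :
    siteOp i A * siteOp i B = siteOp i (A * B) := by
  rw [siteOp, siteOp, siteOp, tens_mul]
  congr 1
  ext1 j
  split_ifs <;> simp

lemma siteOp_one (i : Fin n) : siteOp i 1 = 1 := by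
  simp [siteOp, tens_one]

lemma siteOp_smul (i : Fin n) (c : ℂ) (A : Matrix (Fin 2) (Fin 2) ℂ) :
    siteOp i (c • A) = c • siteOp i A := by
  have : (fun j => if j = i then c • A else 1) =
      fun j => (if j = i then c else 1) • (if j = i then A else 1) := by
    ext1 j
    split_ifs <;> simp
  rw [siteOp, this, tens_smul]
  simp [siteOp]

lemma siteOp_neg (i : Fin n) (A : Matrix (Fin 2) (Fin 2) ℂ) : siteOp i (-A) = -siteOp i A := by
  simpa using siteOp_smul i (-1) A

lemma siteOp_apply (i : Fin n) (A : Matrix (Fin 2) (Fin 2) ℂ) (v w : Fin n → Fin 2) :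
    siteOp i A v w =
      A (v i) (w i) * ∏ j ∈ Finset.univ.erase i, (1 : Matrix (Fin 2) (Fin 2) ℂ) (v j) (w j) := by
  rw [siteOp, tens, Matrix.of_apply, ← Finset.mul_prod_erase _ _ (Finset.mem_univ i), if_pos rfl]
  congr 1
  exact Finset.prod_congr rfl fun j hj => by rw [if_neg (Finset.ne_of_mem_erase hj)]

lemma siteOp_sum {ι : Type*} (s : Finset ι) (i : Fin n) (A : ι → Matrix (Fin 2) (Fin 2) ℂ) :
    siteOp i (∑ k ∈ s, A k) = ∑ k ∈ s, siteOp i (A k) := by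
  ext v w
  simp [siteOp_apply, Matrix.sum_apply, Finset.sum_mul]

lemma conjTranspose_siteOp (i : Fin n) (A : Matrix (Fin 2) (Fin 2) ℂ) :
    (siteOp i A)ᴴ = siteOp i Aᴴ := by
  rw [siteOp, conjTranspose_tens, siteOp]
  congr 1
  ext1 j
  split_ifs <;> simp

lemma siteOp_mulVec_tensVec {i : Fin n} {A : Matrix (Fin 2) (Fin 2) ℂ} {φ : Fin n → Fin 2 → ℂ}
    {c : ℂ} (hA : A *ᵥ φ i = c • φ i) : siteOp i A *ᵥ tensVec φ = c • tensVec φ := by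
  have : (fun j => (if j = i then A else 1) *ᵥ φ j) = fun j => (if j = i then c else 1) • φ j := by
    ext1 j
    split_ifs with hj
    · rw [hj, hA]
    · simp
  rw [siteOp, tens_mulVec_tensVec, this, tensVec_smul]
  simp

lemma tens_mul_siteOp {P : Fin n → Matrix (Fin 2) (Fin 2) ℂ} {i : Fin n}
    {B : Matrix (Fin 2) (Fin 2) ℂ} {c : ℂ} (hB : P i * B = c • (B * P i)) :
    tens P * siteOp i B = c • (siteOp i B * tens P) := by
  have : (fun j => P j * if j = i then B else 1) =
      fun j => (if j = i then c else 1) • ((if j = i then B else 1) * P j) := by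
    ext1 j
    split_ifs with hj
    · rw [hj, hB]
    · simp
  rw [siteOp, tens_mul, tens_mul, this, tens_smul]
  simp

end Tensor

/-! ### Expectation values -/

section ExpVal

variable {m : Type*} [Fintype m]

/-- The expectation value `⟨ψ, M ψ⟩`. -/
def expVal (ψ : m → ℂ) (M : Matrix m m ℂ) : ℂ := star ψ ⬝ᵥ M *ᵥ ψ

lemma expVal_smul (ψ : m → ℂ) (c : ℂ) (M : Matrix m m ℂ) :
    expVal ψ (c • M) = c * expVal ψ M := by
  simp [expVal, Matrix.smul_mulVec]

lemma expVal_sum {ι : Type*} (s : Finset ι) (ψ : m → ℂ) (M : ι → Matrix m m ℂ) :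
    expVal ψ (∑ k ∈ s, M k) = ∑ k ∈ s, expVal ψ (M k) := by
  simp [expVal, Matrix.sum_mulVec, dotProduct_sum]

lemma expVal_eq_of_mulVec {ψ : m → ℂ} {M : Matrix m m ℂ} {c : ℂ} (hM : M *ᵥ ψ = c • ψ) :
    expVal ψ M = c * (star ψ ⬝ᵥ ψ) := by
  simp [expVal, hM]

lemma re_star_dotProduct_self_nonneg (ψ : m → ℂ) : 0 ≤ (star ψ ⬝ᵥ ψ).re := by
  open scoped ComplexOrder in
  exact (Complex.le_def.1 (dotProduct_star_self_nonneg ψ)).1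

variable [DecidableEq m]

lemma neg_mul_le_re_expVal (ψ : m → ℂ) {M : Matrix m m ℂ} {r : ℝ} (hr : 0 ≤ r) (hM : Mᴴ = M)
    (hM2 : M * M = ((r : ℂ) ^ 2) • 1) : -(r * (star ψ ⬝ᵥ ψ).re) ≤ (expVal ψ M).re := by
  have key : star (M *ᵥ ψ) ⬝ᵥ (M *ᵥ ψ) = (r : ℂ) ^ 2 * (star ψ ⬝ᵥ ψ) := by
    rw [Matrix.star_mulVec, hM, ← Matrix.dotProduct_mulVec, Matrix.mulVec_mulVec, hM2]
    simp [Matrix.smul_mulVec]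
  rcases hr.eq_or_lt with rfl | hr
  · have h0 : M *ᵥ ψ = 0 := by
      open scoped ComplexOrder in
      exact dotProduct_star_self_eq_zero.1 (by simpa using key)
    simp [expVal, h0]
  · have h1 := re_star_dotProduct_self_nonneg (M *ᵥ ψ + (r : ℂ) • ψ)
    have h2 : star (M *ᵥ ψ) ⬝ᵥ ψ = expVal ψ M := by
      rw [Matrix.star_mulVec, hM, ← Matrix.dotProduct_mulVec, expVal]
    have h3 : star (M *ᵥ ψ + (r : ℂ) • ψ) ⬝ᵥ (M *ᵥ ψ + (r : ℂ) • ψ) =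
        ((2 * r : ℝ) : ℂ) * (((r : ℝ) : ℂ) * (star ψ ⬝ᵥ ψ) + expVal ψ M) := by
      rw [star_add, add_dotProduct, dotProduct_add, dotProduct_add, key, star_smul,
        smul_dotProduct, smul_dotProduct, dotProduct_smul, dotProduct_smul, h2]
      simp only [Complex.star_def, Complex.conj_ofReal, smul_eq_mul]
      rw [← expVal]
      push_cast
      ring
    rw [h3, Complex.re_ofReal_mul, Complex.add_re, Complex.re_ofReal_mul] at h1
    linarith [nonneg_of_mul_nonneg_right h1 (by positivity : (0 : ℝ) < 2 * r)]

lemma expVal_eq_zero_of_anticomm {ψ : m → ℂ} {A B : Matrix m m ℂ} (hA : Aᴴ * A = 1)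
    (hψ : A *ᵥ ψ = ψ) (hAB : A * B = -(B * A)) : expVal ψ B = 0 := by
  have h1 : Aᴴ *ᵥ ψ = ψ := by
    nth_rewrite 1 [← hψ]
    rw [Matrix.mulVec_mulVec, hA, Matrix.one_mulVec]
  have h2 : star ψ ᵥ* A = star ψ := by
    rw [← Matrix.conjTranspose_conjTranspose A, ← Matrix.star_mulVec, h1]
  have h3 : expVal ψ B = -expVal ψ B := by
    calc expVal ψ B = star ψ ⬝ᵥ (A * B) *ᵥ ψ := by
          rw [← Matrix.mulVec_mulVec, Matrix.dotProduct_mulVec (star ψ) A, h2, expVal]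
      _ = -expVal ψ B := by
          rw [hAB, Matrix.neg_mulVec, ← Matrix.mulVec_mulVec, hψ, dotProduct_neg, expVal]
  exact self_eq_neg.1 h3

/-- A traceless `M` with `M² = r²` has a unit eigenvector with eigenvalue `-r`. -/
lemma exists_unit_eigenvector [Nonempty m] {M : Matrix m m ℂ} {r : ℝ} (htr : M.trace = 0)
    (hM2 : M * M = ((r : ℂ) ^ 2) • 1) :
    ∃ φ : m → ℂ, star φ ⬝ᵥ φ = 1 ∧ M *ᵥ φ = (-r : ℂ) • φ := by
  obtain ⟨φ, hφ, hM⟩ : ∃ φ : m → ℂ, φ ≠ 0 ∧ M *ᵥ φ = (-r : ℂ) • φ := by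
    by_cases hMr : M = (r : ℂ) • 1
    · have hr : (r : ℂ) = 0 := by simpa [hMr, Matrix.trace_smul] using htr
      exact ⟨fun _ => 1, fun h => one_ne_zero (congrFun h (Classical.arbitrary m)),
        by simp [hMr, hr]⟩
    · obtain ⟨x, hx⟩ : ∃ x, (M - (r : ℂ) • 1) *ᵥ x ≠ 0 := by
        by_contra! h0
        refine hMr (sub_eq_zero.1 (Matrix.ext_of_mulVec_single fun i => ?_))
        rw [h0, Matrix.zero_mulVec]
      refine ⟨_, hx, ?_⟩
      rw [Matrix.mulVec_mulVec, ← Matrix.smul_mulVec]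
      congr 1
      rw [mul_sub, hM2, smul_sub, smul_smul]
      simp only [mul_smul_comm, mul_one, neg_smul, neg_mul, sq]
      abel
  have hpos : 0 < (star φ ⬝ᵥ φ).re ∧ 0 = (star φ ⬝ᵥ φ).im := by
    open scoped ComplexOrder in
    exact Complex.lt_def.1 (dotProduct_star_self_pos_iff.2 hφ)
  set N := (star φ ⬝ᵥ φ).re
  have hN : star φ ⬝ᵥ φ = (N : ℂ) := Complex.ext rfl (by simp [← hpos.2])
  refine ⟨((Real.sqrt N)⁻¹ : ℂ) • φ, ?_, ?_⟩
  · have hs : (Real.sqrt N : ℂ) * Real.sqrt N = N := by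
      rw [← Complex.ofReal_mul, Real.mul_self_sqrt hpos.1.le]
    have hN0 : (N : ℂ) ≠ 0 := by exact_mod_cast hpos.1.ne'
    rw [star_smul, smul_dotProduct, dotProduct_smul, hN]
    simp only [Complex.star_def, map_inv₀, Complex.conj_ofReal, smul_eq_mul]
    rw [← mul_assoc, ← mul_inv, hs, inv_mul_cancel₀ hN0]
  · rw [Matrix.mulVec_smul, hM, smul_comm]

end ExpVal

/-! ### Trace of idempotents -/

section Idempotent

variable {m : Type*} [Fintype m] [DecidableEq m]

lemma exists_nat_trace_eq_of_isIdempotentElem {P : Matrix m m ℂ} (hP : P * P = P) :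
    ∃ d : ℕ, P.trace = d := by
  have h : IsIdempotentElem (Matrix.toLin' P) := by
    rw [IsIdempotentElem, Module.End.mul_eq_comp, ← Matrix.toLin'_mul, hP]
  exact ⟨_, by rw [← Matrix.trace_toLin'_eq, (LinearMap.IsIdempotentElem.isProj_range _ h).trace]⟩

/-- A rank-one idempotent cannot commute with two anticommuting involutions. -/
lemma not_commute_anticomm_involutions {P X Y : Matrix m m ℂ} (hP : P * P = P)
    (htr : P.trace = 1) (hX : X * X = 1) (hY : Y * Y = 1) (hXY : X * Y = -(Y * X))
    (hPX : P * X = X * P) (hPY : P * Y = Y * P) : False := by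
  have h0 : (P * X).trace = 0 := by
    have h1 : (P * X).trace = -(P * X).trace := by
      calc (P * X).trace = (P * X * (Y * Y)).trace := by rw [hY, mul_one]
        _ = (Y * (P * X * Y)).trace := by rw [← mul_assoc, Matrix.trace_mul_comm]
        _ = (P * (Y * X) * Y).trace := by
            rw [← mul_assoc, ← mul_assoc, ← hPY]
            simp only [mul_assoc]
        _ = -(P * X).trace := by
            rw [← neg_eq_iff_eq_neg.2 hXY, mul_neg, neg_mul, Matrix.trace_neg, mul_assoc,
              mul_assoc, hY, mul_one]
    exact self_eq_neg.1 h1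
  have hPXPX : P * X * (P * X) = P := by
    rw [mul_assoc, ← mul_assoc X, ← hPX, mul_assoc, hX, mul_one, hP]
  have hQ : (2⁻¹ : ℂ) • (P + P * X) * ((2⁻¹ : ℂ) • (P + P * X)) = (2⁻¹ : ℂ) • (P + P * X) := by
    have h2 : P * X * P = P * X := by rw [mul_assoc, ← hPX, ← mul_assoc, hP]
    have h3 : P * (P * X) = P * X := by rw [← mul_assoc, hP]
    rw [smul_mul_smul_comm, add_mul, mul_add, mul_add, hP, h2, h3, hPXPX]
    module
  obtain ⟨d, hd⟩ := exists_nat_trace_eq_of_isIdempotentElem hQ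
  rw [Matrix.trace_smul, Matrix.trace_add, h0, htr] at hd
  have h4 : ((1 : ℕ) : ℂ) = ((2 * d : ℕ) : ℂ) := by
    push_cast
    rw [← hd]
    simp
  have := Nat.cast_injective h4
  omega

end Idempotent

/-! ### Stabilizer groups -/

section Stab

variable {n : ℕ} {S : Set (QOp n)}

lemma IsPauli.mul_self {A : QOp n} (hA : IsPauli A) : A * A = 1 ∨ A * A = -1 := by
  obtain ⟨c, hc, P, hP, rfl⟩ := hA
  have : (fun i => P i * P i) = fun _ => 1 := by
    ext1 i
    rcases eq_one_or_eq_pauli_iff.1 (hP i) with h | ⟨k, h⟩ <;> simp [h, pauli_mul_self]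
  rw [smul_mul_smul_comm, tens_mul, this, tens_one]
  rcases hc with rfl | rfl | rfl | rfl <;> simp

lemma IsPauli.conjTranspose_mul_self {A : QOp n} (hA : IsPauli A) : Aᴴ * A = 1 := by
  obtain ⟨c, hc, P, hP, rfl⟩ := hA
  have : (fun i => (P i)ᴴ * P i) = fun _ => 1 := by
    ext1 i
    rcases eq_one_or_eq_pauli_iff.1 (hP i) with h | ⟨k, h⟩ <;>
      simp [h, pauli_mul_self, conjTranspose_pauli]
  rw [Matrix.conjTranspose_smul, smul_mul_smul_comm, conjTranspose_tens, tens_mul, this, tens_one]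
  rcases hc with rfl | rfl | rfl | rfl <;> simp

lemma IsPauli.trace_eq_zero_or {A : QOp n} (hA : IsPauli A) :
    A.trace = 0 ∨ A = 1 ∨ A = -1 ∨ A * A = -1 := by
  obtain ⟨c, hc, P, hP, rfl⟩ := hA
  by_cases h1 : ∀ i, P i = 1
  · right
    rw [show P = fun _ => 1 from funext h1, tens_one]
    rcases hc with rfl | rfl | rfl | rfl <;> simp [smul_smul]
  · left
    obtain ⟨i, hi⟩ := not_forall.1 h1
    obtain ⟨k, hk⟩ := (eq_one_or_eq_pauli_iff.1 (hP i)).resolve_left hi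
    rw [Matrix.trace_smul, trace_tens,
      Finset.prod_eq_zero (Finset.mem_univ i) (by rw [hk, trace_pauli]), smul_zero]

lemma IsPauli.commute_or_anticomm {A : QOp n} (hA : IsPauli A) (i : Fin n) (k : Fin 3) :
    A * siteOp i (pauli k) = siteOp i (pauli k) * A ∨
      A * siteOp i (pauli k) = -(siteOp i (pauli k) * A) := by
  obtain ⟨c, -, P, hP, rfl⟩ := hA
  have h : P i * pauli k = (1 : ℂ) • (pauli k * P i) ∨
      P i * pauli k = (-1 : ℂ) • (pauli k * P i) := by
    rcases eq_one_or_eq_pauli_iff.1 (hP i) with h | ⟨l, h⟩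
    · simp [h]
    · rcases eq_or_ne l k with rfl | hlk
      · simp [h]
      · simp [h, pauli_anticomm hlk]
  refine h.imp (fun h => ?_) (fun h => ?_) <;>
    simp [tens_mul_siteOp h]

lemma IsStabGroup.mul_self (hS : IsStabGroup S) {A : QOp n} (hA : A ∈ S) : A * A = 1 :=
  (hS.pauli A hA).mul_self.resolve_right fun h => hS.neg_one_not_mem (h ▸ hS.mul_mem A hA A hA)

lemma IsStabGroup.trace_eq_zero (hS : IsStabGroup S) {A : QOp n} (hA : A ∈ S) (hA1 : A ≠ 1) :
    A.trace = 0 := by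
  rcases (hS.pauli A hA).trace_eq_zero_or with h | h | h | h
  · exact h
  · exact absurd h hA1
  · exact absurd (h ▸ hA) hS.neg_one_not_mem
  · exact absurd (h ▸ hS.mul_mem A hA A hA) hS.neg_one_not_mem

lemma IsMaxStabGroup.finite (hS : IsMaxStabGroup S) : Finite S :=
  Nat.finite_of_card_ne_zero (by rw [hS.2]; positivity)

/-- A maximal stabilizer group averages to an idempotent of trace one. -/
lemma IsMaxStabGroup.exists_idempotent (hS : IsMaxStabGroup S) :
    ∃ P : QOp n, P * P = P ∧ P.trace = 1 ∧
      ∀ B : QOp n, (∀ A ∈ S, A * B = B * A) → P * B = B * P := by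
  have := hS.finite
  have := Fintype.ofFinite S
  have hcard : (Fintype.card S : ℂ) = 2 ^ n := by
    rw [← Nat.card_eq_fintype_card, hS.2]
    push_cast
    rfl
  have h2 : (2 : ℂ) ^ n ≠ 0 := pow_ne_zero n two_ne_zero
  have hmul : ∀ A : S, (A : QOp n) * ∑ B : S, (B : QOp n) = ∑ B : S, (B : QOp n) := by
    intro A
    have hinv : Function.Involutive fun B : S =>
        (⟨A * B, hS.1.mul_mem A A.2 B B.2⟩ : S) := fun B => by
      ext1
      simp only [← mul_assoc, hS.1.mul_self A.2, one_mul]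
    rw [Finset.mul_sum]
    exact Fintype.sum_bijective _ hinv.bijective _ _ fun _ => rfl
  refine ⟨((2 : ℂ) ^ n)⁻¹ • ∑ A : S, (A : QOp n), ?_, ?_, fun B hB => ?_⟩
  · rw [smul_mul_smul_comm, Finset.sum_mul, Finset.sum_congr rfl fun A _ => hmul A,
      Finset.sum_const, Finset.card_univ, ← Nat.cast_smul_eq_nsmul ℂ, hcard, smul_smul, mul_assoc,
      inv_mul_cancel₀ h2, mul_one]
  · rw [Matrix.trace_smul, Matrix.trace_sum, Finset.sum_eq_single (⟨1, hS.1.one_mem⟩ : S)]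
    · simp [Matrix.trace_one]
    · exact fun A _ hA => hS.1.trace_eq_zero A.2 fun h => hA (Subtype.ext h)
    · simp
  · rw [smul_mul_assoc, mul_smul_comm, Finset.sum_mul, Finset.mul_sum,
      Finset.sum_congr rfl fun (A : S) _ => hB A A.2]

/-- At each site, at most one Pauli matrix has nonzero expectation in a stabilizer state. -/
lemma exists_expVal_pauli_eq_zero {ψ : QVec n} (hψ : IsPureStab ψ) (i : Fin n) :
    ∃ k, ∀ l, l ≠ k → expVal ψ (siteOp i (pauli l)) = 0 := by
  obtain ⟨-, S, hS, hfix⟩ := hψ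
  have hcomm : ∀ l, expVal ψ (siteOp i (pauli l)) ≠ 0 →
      ∀ A ∈ S, A * siteOp i (pauli l) = siteOp i (pauli l) * A := fun l hl A hA =>
    ((hS.1.pauli A hA).commute_or_anticomm i l).resolve_right fun h =>
      hl (expVal_eq_zero_of_anticomm (hS.1.pauli A hA).conjTranspose_mul_self (hfix A hA) h)
  by_contra! hcon
  obtain ⟨k, -, hk⟩ := hcon 0
  obtain ⟨l, hlk, hl⟩ := hcon k
  obtain ⟨P, hP, htr, hPc⟩ := hS.exists_idempotent
  refine not_commute_anticomm_involutions hP htr (X := siteOp i (pauli l))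
    (Y := siteOp i (pauli k)) ?_ ?_ ?_ (hPc _ (hcomm l hl)) (hPc _ (hcomm k hk)) <;>
    simp only [siteOp_mul, pauli_mul_self, siteOp_one, pauli_anticomm hlk, siteOp_neg]

lemma expVal_siteOp_dotSigma (ψ : QVec n) (i : Fin n) (r : Fin 3 → ℝ) :
    expVal ψ (siteOp i (dotSigma r)) = ∑ k, (r k : ℂ) * expVal ψ (siteOp i (pauli k)) := by
  rw [dotSigma_eq_sum, siteOp_sum, expVal_sum]
  simp only [siteOp_smul, expVal_smul]

lemma siteOp_dotSigma_mul_self (i : Fin n) (r : Fin 3 → ℝ) :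
    siteOp i (dotSigma r) * siteOp i (dotSigma r) =
      ((Real.sqrt (∑ k, r k ^ 2) : ℂ) ^ 2) • 1 := by
  rw [siteOp_mul, dotSigma_mul_self, siteOp_smul, siteOp_one]

lemma abs_re_expVal_pauli_le_one {ψ : QVec n} (hψ : star ψ ⬝ᵥ ψ = 1) (i : Fin n) (k : Fin 3) :
    |(expVal ψ (siteOp i (pauli k))).re| ≤ 1 := by
  have hH : (siteOp i (pauli k))ᴴ = siteOp i (pauli k) := by
    rw [conjTranspose_siteOp, conjTranspose_pauli]
  have hsq : siteOp i (pauli k) * siteOp i (pauli k) = ((1 : ℝ) : ℂ) ^ 2 • 1 := by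
    simp [siteOp_mul, pauli_mul_self, siteOp_one]
  have h1 := neg_mul_le_re_expVal ψ zero_le_one hH hsq
  have h2 := neg_mul_le_re_expVal ψ (M := -siteOp i (pauli k)) zero_le_one
    (by rw [Matrix.conjTranspose_neg, hH]) (by rw [neg_mul_neg, hsq])
  rw [show -siteOp i (pauli k) = (-1 : ℂ) • siteOp i (pauli k) by simp, expVal_smul] at h2
  simp only [hψ, Complex.one_re, mul_one, neg_mul, one_mul, Complex.neg_re] at h1 h2
  exact abs_le.2 ⟨h1, by linarith⟩

lemma neg_iSup_abs_le_re_expVal {ψ : QVec n} (hψ : IsPureStab ψ) (i : Fin n) (r : Fin 3 → ℝ) :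
    -(⨆ k, |r k|) ≤ (expVal ψ (siteOp i (dotSigma r))).re := by
  obtain ⟨k, hk⟩ := exists_expVal_pauli_eq_zero hψ i
  rw [expVal_siteOp_dotSigma, Fintype.sum_eq_single k fun l hl => by rw [hk l hl, mul_zero],
    Complex.re_ofReal_mul]
  refine neg_le_of_abs_le ?_
  rw [abs_mul]
  calc |r k| * |(expVal ψ (siteOp i (pauli k))).re|
      ≤ |r k| * 1 := by gcongr; exact abs_re_expVal_pauli_le_one hψ.1 i k
    _ ≤ ⨆ k, |r k| := by
      rw [mul_one]
      exact le_ciSup (f := fun k => |r k|) (Set.finite_range _).bddAbove k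

lemma trace_mul_proj (H : QOp n) (ψ : QVec n) : (H * proj ψ).trace = expVal ψ H := by
  rw [proj, Matrix.mul_vecMulVec, Matrix.trace_vecMulVec, dotProduct_comm, expVal]

lemma le_re_trace_of_mem_stabPolytope {H : QOp n} {c : ℝ}
    (hc : ∀ ψ : QVec n, IsPureStab ψ → c ≤ (expVal ψ H).re) {ρ : QOp n}
    (hρ : ρ ∈ StabPolytope n) : c ≤ (H * ρ).trace.re := by
  have hconv : Convex ℝ {ρ : QOp n | c ≤ (H * ρ).trace.re} :=
    convex_halfSpace_ge (f := fun ρ : QOp n => (H * ρ).trace.re)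
      ⟨fun x y => by simp [mul_add], fun a x => by simp [Matrix.trace_smul]⟩ c
  refine convexHull_min ?_ hconv hρ
  rintro _ ⟨ψ, hψ, rfl⟩
  rw [Set.mem_ofPred_eq, trace_mul_proj]
  exact hc ψ hψ

/-- The group generated by the signed single-site Pauli operators `s i • pauli (κ i)`. -/
def signedPauliGroup (s : Fin n → ℂ) (κ : Fin n → Fin 3) : Set (QOp n) :=
  Set.range fun b : Fin n → Bool => tens fun i => if b i then s i • pauli (κ i) else 1

lemma signedPauli_mul {s : ℂ} (hs : s = 1 ∨ s = -1) (k : Fin 3) (b c : Bool) :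
    ((if b then s • pauli k else 1) * if c then s • pauli k else 1) =
      if b ^^ c then s • pauli k else 1 := by
  have : s * s = 1 := by rcases hs with rfl | rfl <;> simp
  cases b <;> cases c <;> simp [pauli_mul_self, smul_smul, this]

lemma isMaxStabGroup_signedPauliGroup {s : Fin n → ℂ} (hs : ∀ i, s i = 1 ∨ s i = -1)
    (κ : Fin n → Fin 3) : IsMaxStabGroup (signedPauliGroup s κ) := by
  have hmul : ∀ b c : Fin n → Bool,
      (tens fun i => if b i then s i • pauli (κ i) else 1) *
        (tens fun i => if c i then s i • pauli (κ i) else 1) =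
      tens fun i => if b i ^^ c i then s i • pauli (κ i) else 1 := fun b c => by
    simp only [tens_mul, signedPauli_mul (hs _)]
  have htr : ∀ b : Fin n → Bool, (tens fun i => if b i then s i • pauli (κ i) else 1).trace ≠ 0 →
      ∀ i, b i = false := fun b hb i => by
    by_contra hi
    refine hb ?_
    rw [trace_tens, Finset.prod_eq_zero (Finset.mem_univ i)]
    simp [Bool.eq_true_of_not_eq_false hi, Matrix.trace_smul, trace_pauli]
  have htr1 : (1 : QOp n).trace ≠ 0 := by simp [Matrix.trace_one]
  refine ⟨⟨?_, ⟨fun _ => false, by simp [tens_one]⟩, ?_, ?_, ?_⟩, ?_⟩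
  · rintro _ ⟨b, rfl⟩
    refine ⟨∏ i, if b i then s i else 1, ?_, fun i => if b i then pauli (κ i) else 1, fun i => ?_, ?_⟩
    · rw [← or_assoc]
      left
      refine Finset.prod_induction _ (fun c : ℂ => c = 1 ∨ c = -1) ?_ (Or.inl rfl) fun i _ => ?_
      · rintro a b (rfl | rfl) (rfl | rfl) <;> simp
      · split_ifs
        exacts [hs i, Or.inl rfl]
    · rw [eq_one_or_eq_pauli_iff]
      dsimp only
      split_ifs
      exacts [Or.inr ⟨_, rfl⟩, Or.inl rfl]
    · rw [← tens_smul]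
      refine congrArg tens (funext fun i => ?_)
      split_ifs <;> simp
  · rintro _ ⟨b, rfl⟩ _ ⟨c, rfl⟩
    exact ⟨fun i => b i ^^ c i, (hmul b c).symm⟩
  · rintro _ ⟨b, rfl⟩ _ ⟨c, rfl⟩
    simp only [hmul, Bool.xor_comm]
  · rintro ⟨b, hb⟩
    have hb0 := htr b (by
      simp only at hb
      rw [hb, Matrix.trace_neg]
      exact neg_ne_zero.2 htr1)
    simp only [hb0, Bool.false_eq_true, if_false, tens_one] at hb
    have htr2 := congrArg Matrix.trace hb
    rw [Matrix.trace_neg] at htr2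
    exact htr1 (self_eq_neg.1 htr2)
  · have hinj : Function.Injective fun b : Fin n → Bool =>
        tens fun i => if b i then s i • pauli (κ i) else 1 := fun b c hbc => by
      have h1 := hmul b c
      have h2 := hmul c c
      simp only at hbc
      rw [hbc, h2] at h1
      simp only [Bool.xor_self, Bool.false_eq_true, if_false, tens_one] at h1
      have h3 := htr _ (h1 ▸ htr1)
      ext1 i
      simpa using h3 i
    rw [signedPauliGroup, Nat.card_range_of_injective hinj]
    simp

/-- A product state attaining the minimal stabilizer energy at every site. -/
lemma exists_isPureStab_re_expVal (h : Fin n → Fin 3 → ℝ) :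
    ∃ ψ : QVec n, IsPureStab ψ ∧
      ∀ i, (expVal ψ (siteOp i (dotSigma (h i)))).re = -⨆ k, |h i k| := by
  choose κ hκ using fun i => exists_eq_ciSup_of_finite (f := fun k => |h i k|)
  have hs : ∀ i, ∃ s : ℝ, (s = 1 ∨ s = -1) ∧ h i (κ i) * s = -|h i (κ i)| := fun i => by
    rcases abs_choice (h i (κ i)) with hi | hi
    · exact ⟨-1, Or.inr rfl, by rw [hi]; ring⟩
    · exact ⟨1, Or.inl rfl, by rw [hi]; ring⟩
  choose s hs hhs using hs
  have hsC : ∀ i, (s i : ℂ) = 1 ∨ (s i : ℂ) = -1 := fun i => by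
    exact_mod_cast hs i
  have hss : ∀ i, (s i : ℂ) * s i = 1 := fun i => by
    rcases hsC i with h | h <;> simp [h]
  have hφ : ∀ i, ∃ φ : Fin 2 → ℂ, star φ ⬝ᵥ φ = 1 ∧ pauli (κ i) *ᵥ φ = (s i : ℂ) • φ := fun i => by
    obtain ⟨φ, hφ1, hφ⟩ := exists_unit_eigenvector (M := pauli (κ i)) (r := -s i)
      (trace_pauli _) (by rw [pauli_mul_self, Complex.ofReal_neg, neg_sq, sq, hss, one_smul])
    exact ⟨φ, hφ1, by simpa using hφ⟩
  choose φ hφ1 hφ using hφ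
  have hψ1 : star (tensVec φ) ⬝ᵥ tensVec φ = 1 := by
    rw [star_tensVec_dotProduct, Finset.prod_congr rfl fun i _ => hφ1 i, Finset.prod_const_one]
  have hstab : IsPureStab (tensVec φ) := by
    refine ⟨hψ1, _, isMaxStabGroup_signedPauliGroup hsC κ, ?_⟩
    rintro _ ⟨b, rfl⟩
    simp only [tens_mulVec_tensVec]
    congr 1
    ext1 i
    split_ifs
    · rw [Matrix.smul_mulVec, hφ, smul_smul, hss, one_smul]
    · rw [Matrix.one_mulVec]
  refine ⟨tensVec φ, hstab, fun i => ?_⟩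
  have hk : expVal (tensVec φ) (siteOp i (pauli (κ i))) = s i := by
    rw [expVal_eq_of_mulVec (siteOp_mulVec_tensVec (hφ i)), hψ1, mul_one]
  obtain ⟨k, hk0⟩ := exists_expVal_pauli_eq_zero hstab i
  have hkk : κ i = k := by
    by_contra hne
    have := hss i
    rw [← hk, hk0 _ hne, mul_zero] at this
    exact zero_ne_one this
  rw [expVal_siteOp_dotSigma,
    Fintype.sum_eq_single (κ i) fun l hl => by rw [hk0 l (hkk ▸ hl), mul_zero], hk,
    ← Complex.ofReal_mul, Complex.ofReal_re, hhs, ← hκ]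

end Stab

/-! ### Energies of non-interacting Hamiltonians -/

lemma minEig_sum_siteOp {n : ℕ} (h : Fin n → Fin 3 → ℝ) :
    minEig (∑ i, siteOp i (dotSigma (h i))) = -∑ i, Real.sqrt (∑ k, h i k ^ 2) := by
  refine IsLeast.csInf_eq ⟨?_, ?_⟩
  · choose φ hφ1 hφ using fun i => exists_unit_eigenvector (trace_dotSigma (h i))
      (dotSigma_mul_self (h i))
    refine ⟨tensVec φ, fun h0 => ?_, ?_⟩
    · have := star_tensVec_dotProduct φ
      simp [h0, hφ1] at this
    · rw [Matrix.sum_mulVec, Finset.sum_congr rfl fun i _ => siteOp_mulVec_tensVec (hφ i),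
        ← Finset.sum_smul]
      simp
  · rintro E ⟨ψ, hψ, hE⟩
    have hpos : 0 < (star ψ ⬝ᵥ ψ).re := by
      open scoped ComplexOrder in
      exact (Complex.lt_def.1 (dotProduct_star_self_pos_iff.2 hψ)).1
    have h1 := congrArg Complex.re (expVal_eq_of_mulVec hE)
    rw [Complex.re_ofReal_mul, expVal_sum, Complex.re_sum] at h1
    refine le_of_mul_le_mul_right ?_ hpos
    rw [← h1, neg_mul, Finset.sum_mul, ← Finset.sum_neg_distrib]
    exact Finset.sum_le_sum fun i _ => neg_mul_le_re_expVal ψ (Real.sqrt_nonneg _)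
      (by rw [conjTranspose_siteOp, conjTranspose_dotSigma]) (siteOp_dotSigma_mul_self i (h i))

lemma stabEnergy_sum_siteOp {n : ℕ} (h : Fin n → Fin 3 → ℝ) :
    stabEnergy (∑ i, siteOp i (dotSigma (h i))) = -∑ i, ⨆ k, |h i k| := by
  refine IsLeast.csInf_eq ⟨?_, ?_⟩
  · obtain ⟨ψ, hψ, hE⟩ := exists_isPureStab_re_expVal h
    refine ⟨proj ψ, subset_convexHull ℝ _ ⟨ψ, hψ, rfl⟩, ?_⟩
    simp only [trace_mul_proj, expVal_sum, Complex.re_sum, hE, Finset.sum_neg_distrib]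
  · rintro _ ⟨ρ, hρ, rfl⟩
    refine le_re_trace_of_mem_stabPolytope (fun ψ hψ => ?_) hρ
    rw [expVal_sum, Complex.re_sum, ← Finset.sum_neg_distrib]
    exact Finset.sum_le_sum fun i _ => neg_iSup_abs_le_re_expVal hψ i (h i)

/-- for non-interacting Hamiltonians the stabilizer gap is
additive over the sites. -/
theorem stab_gap_additive_noninteracting {n : ℕ} (h : Fin n → Fin 3 → ℝ)
    (H : QOp n) (hH : H = ∑ i, siteOp i (dotSigma (h i))) :
    minEig H = -∑ i, Real.sqrt (∑ k, h i k ^ 2) ∧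
    stabEnergy H = -∑ i, ⨆ k, |h i k| ∧
    stabGap H = ∑ i, (Real.sqrt (∑ k, h i k ^ 2) - ⨆ k, |h i k|) := by
  subst hH
  refine ⟨minEig_sum_siteOp h, stabEnergy_sum_siteOp h, ?_⟩
  rw [stabGap, minEig_sum_siteOp, stabEnergy_sum_siteOp, Finset.sum_sub_distrib]
  ring
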